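/- arXiv:quant-ph/0001087 — 8 statements merged into one kernel-verified Lean document; each statement's English description precedes it below -/
import Mathlib

section
/- Let (K, M, ψ) be a monotone span program over a player set P computing the monotone function f, and let B ⊆ P with f(B) = 0 (i.e. B ∈ A_f). Then the shares of B reveal no information about the secret: for all s, s' ∈ K there exists a bijection σ : K^{e-1} → K^{e-1} such that M_B (s; a) = M_B (s'; σ(a)) for every a ∈ K^{e-1}. In particular, when a is uniformly random, the distribution of M_B (s; a) is the same for every secret s. -/
open Matrix

/-- For a monotone span program with matrix `M : Matrix (Fin d) (Fin (e+1)) K`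
and labelling `ψ : Fin d → P`, the submatrix `M_B` of rows labelled in `B`. -/
def mspSub {P : Type*} [DecidableEq P] {K : Type*} {d e : ℕ}
    (M : Matrix (Fin d) (Fin (e + 1)) K) (ψ : Fin d → P) (B : Finset P) :
    Matrix {l : Fin d // ψ l ∈ B} (Fin (e + 1)) K :=
  Matrix.of fun l j => M l.1 j

/-- The target vector `ε = (1,0,…,0) ∈ K^(e+1)`. -/
def mspTarget (K : Type*) [Zero K] [One K] (e : ℕ) : Fin (e + 1) → K :=
  Pi.single 0 1

/-- A vector outside the image of `Aᵀ` is separated from it by a vector in the kernel of `A`. -/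
theorem Matrix.exists_mulVec_eq_zero_of_notMem_range_transpose
    {K m n : Type*} [Field K] [Fintype m] [Fintype n] (A : Matrix m n K) (w : n → K)
    (hw : ¬ ∃ u : m → K, Aᵀ.mulVec u = w) :
    ∃ v : n → K, A.mulVec v = 0 ∧ w ⬝ᵥ v ≠ 0 := by
  classical
  obtain ⟨f, hfw, hf⟩ := Submodule.exists_le_ker_of_notMem (p := Aᵀ.mulVecLin.range) (v := w)
    (by rintro ⟨u, hu⟩; exact hw ⟨u, hu⟩)
  have f_eq (x : n → K) : f x = x ⬝ᵥ fun i => f fun j => if i = j then 1 else 0 :=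
    f.pi_apply_eq_sum_univ x
  refine ⟨fun i => f fun j => if i = j then 1 else 0, ?_, by rwa [← f_eq]⟩
  ext l
  have hl : f (Aᵀ.mulVec (Pi.single l 1)) = 0 := hf ⟨Pi.single l 1, rfl⟩
  rw [Matrix.mulVec_single_one, f_eq] at hl
  exact hl

/-- Perfect privacy for unqualified sets of a monotone span program: if
`f(B) = 0`, i.e. the target vector `ε` is not in the image of `M_Bᵀ`, then for
any two secrets `s, s'` there is a bijection `σ` of the randomness space
`K^e` such that `M_B (s; a) = M_B (s'; σ(a))` for every `a`.  In particular
the shares of `B` are identically distributed for all secrets. -/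
theorem msp_unqualified_privacy
    {P : Type*} [Fintype P] [DecidableEq P] {K : Type*} [Field K] [Fintype K]
    {d e : ℕ} (M : Matrix (Fin d) (Fin (e + 1)) K) (ψ : Fin d → P) (B : Finset P)
    (hB : ¬ ∃ u : {l : Fin d // ψ l ∈ B} → K,
      (mspSub M ψ B)ᵀ.mulVec u = mspTarget K e) :
    ∀ s s' : K, ∃ σ : (Fin e → K) ≃ (Fin e → K), ∀ a : Fin e → K,
      (mspSub M ψ B).mulVec (Fin.cons s a) =
        (mspSub M ψ B).mulVec (Fin.cons s' (σ a)) := by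
  intro s s'
  obtain ⟨v, hv, hv0⟩ := Matrix.exists_mulVec_eq_zero_of_notMem_range_transpose _ _ hB
  rw [mspTarget, single_one_dotProduct] at hv0
  set c : K := (s' - s) / v 0
  refine ⟨Equiv.addRight (c • Fin.tail v), fun a => ?_⟩
  have hshift : (Fin.cons s' (Equiv.addRight (c • Fin.tail v) a) : Fin (e + 1) → K) =
      Fin.cons s a + c • v := by
    ext i
    refine Fin.cases ?_ (fun j => ?_) i
    · simp [c, hv0]
    · simp [Fin.tail]
  rw [hshift, Matrix.mulVec_add, Matrix.mulVec_smul, hv, smul_zero, add_zero]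
end

section
/- Let (K, M, ψ) be a monotone span program over a player set P computing the monotone function f. Let B ⊆ P with f(B) = 0, let A = P \ B, and suppose f(A) = 1. Let m be the number of rows of M labeled by players in A. Then there exist an invertible m × m matrix U over K, with rows u₁, …, u_m, and a vector v ∈ K^e such that: (1) u₁ᵀ M_A = εᵀ (so the first coordinate of U M_A (s; a) equals s for all s ∈ K, a ∈ K^{e-1}); (2) M_B v = 0, εᵀ v ≠ 0, and uᵢᵀ M_A v = 0 for all i = 2, …, m. -/
open Matrix

/-- If a vector `t` is not in the image of `Nᵀ`, some vector in the kernel of `N` is not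
orthogonal to `t`. -/
theorem exists_mulVec_eq_zero_of_not_exists_transpose_mulVec {K ι κ : Type*} [Field K]
    [Fintype ι] [DecidableEq ι] [Fintype κ] (N : Matrix κ ι K) (t : ι → K)
    (h : ¬ ∃ u, Nᵀ.mulVec u = t) : ∃ v, N.mulVec v = 0 ∧ t ⬝ᵥ v ≠ 0 := by
  have ht : t ∉ LinearMap.range Nᵀ.mulVecLin := fun ⟨u, hu⟩ => h ⟨u, hu⟩
  obtain ⟨φ, hφt, hφ⟩ := Submodule.exists_le_ker_of_notMem ht
  have hφv (x : ι → K) : φ x = x ⬝ᵥ fun j => φ (Pi.single j 1) := by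
    rw [LinearMap.pi_apply_eq_sum_univ φ x]
    simp only [dotProduct, smul_eq_mul]
    refine Finset.sum_congr rfl fun j _ => ?_
    congr 2
    ext l
    simp [Pi.single_apply, eq_comm]
  refine ⟨fun j => φ (Pi.single j 1), dotProduct_eq_zero _ fun y => ?_, by rwa [← hφv]⟩
  rw [dotProduct_comm, dotProduct_mulVec, ← mulVec_transpose, ← hφv]
  exact hφ ⟨y, rfl⟩

/-- A row vector `u` with `u ⬝ᵥ w ≠ 0` extends to an invertible matrix all of whose other rows
are orthogonal to `w`; it may be placed at any position where `w` does not vanish. -/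
theorem exists_isUnit_det_row_eq_orthogonal {K ι : Type*} [Field K] [Fintype ι] [DecidableEq ι]
    {u w : ι → K} {k : ι} (hk : w k ≠ 0) (huw : u ⬝ᵥ w ≠ 0) :
    ∃ U : Matrix ι ι K, IsUnit U.det ∧ U k = u ∧ ∀ i, i ≠ k → U i ⬝ᵥ w = 0 := by
  let U : Matrix ι ι K := fun i =>
    if i = k then u else Pi.single i 1 - Pi.single k (w i / w k)
  have hUk : U k = u := if_pos rfl
  have hU {i : ι} (hi : i ≠ k) (x : ι → K) : U i ⬝ᵥ x = x i - w i / w k * x k := by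
    simp [U, hi, sub_dotProduct]
  refine ⟨U, ?_, hUk, fun i hi => by rw [hU hi]; field_simp; ring⟩
  rw [← isUnit_iff_isUnit_det, ← mulVec_injective_iff_isUnit]
  refine (injective_iff_map_eq_zero U.mulVecLin).2 fun x hx => ?_
  have hrow (i : ι) : U i ⬝ᵥ x = 0 := congrFun hx i
  have hxw : x = (x k / w k) • w := by
    ext i
    by_cases hi : i = k
    · subst hi
      simp [hk]
    · have := hrow i
      rw [hU hi, sub_eq_zero] at this
      rw [this, Pi.smul_apply, smul_eq_mul]
      ring
  have hc := hrow k
  rw [hUk, hxw, dotProduct_smul, smul_eq_mul, mul_eq_zero, or_iff_left huw] at hc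
  rw [hxw, hc, zero_smul]

/-- Existence of the transformation `U` used for quantum reconstruction
(Lemma 1 of the paper).  Let `B` be unqualified (`f(B) = 0`) and let
`A = P \ B` be qualified (`f(A) = 1`), and let `m` be the number of rows of
`M` labelled in `A`.  Then `m > 0` and there are an enumeration `g` of those
rows, an invertible `m × m` matrix `U` with rows `u_1, …, u_m`, and a vector
`v ∈ K^(e+1)` such that: (1) `u_1ᵀ M_A = εᵀ`, so the first coordinate of
`U M_A (s; a)` equals `s` for all `s, a`; and (2) `M_B v = 0`, `εᵀ v ≠ 0`,
and `u_iᵀ M_A v = 0` for all `i ≠ 1`. -/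
theorem msp_reconstruction_transformation
    {P : Type*} [Fintype P] [DecidableEq P] {K : Type*} [Field K] [Fintype K]
    {d e : ℕ} (M : Matrix (Fin d) (Fin (e + 1)) K) (ψ : Fin d → P) (B : Finset P)
    {m : ℕ} (hm : Fintype.card {l : Fin d // ψ l ∈ Bᶜ} = m)
    (hB : ¬ ∃ u : {l : Fin d // ψ l ∈ B} → K,
      (mspSub M ψ B)ᵀ.mulVec u = mspTarget K e)
    (hA : ∃ u : {l : Fin d // ψ l ∈ Bᶜ} → K,
      (mspSub M ψ Bᶜ)ᵀ.mulVec u = mspTarget K e) :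
    ∃ (hm0 : 0 < m) (g : Fin m ≃ {l : Fin d // ψ l ∈ Bᶜ})
      (U : Matrix (Fin m) (Fin m) K) (v : Fin (e + 1) → K),
      IsUnit U.det ∧
      -- (1) the first row of `U · M_A` is the target vector `ε` ...
      (U * Matrix.of fun i j => mspSub M ψ Bᶜ (g i) j) ⟨0, hm0⟩ = mspTarget K e ∧
      (∀ (s : K) (a : Fin e → K),
        U.mulVec ((Matrix.of fun i j => mspSub M ψ Bᶜ (g i) j).mulVec (Fin.cons s a))
          ⟨0, hm0⟩ = s) ∧
      -- (2) `M_B v = 0`, `εᵀ v ≠ 0`, and `u_iᵀ M_A v = 0` for all `i ≠ 1`: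
      (mspSub M ψ B).mulVec v = 0 ∧
      mspTarget K e ⬝ᵥ v ≠ 0 ∧
      (∀ i : Fin m, i ≠ ⟨0, hm0⟩ →
        U i ⬝ᵥ (Matrix.of fun i j => mspSub M ψ Bᶜ (g i) j).mulVec v = 0) := by
  obtain ⟨v, hv, hεv⟩ := exists_mulVec_eq_zero_of_not_exists_transpose_mulVec _ _ hB
  obtain ⟨u, hu⟩ := hA
  have huv : u ⬝ᵥ (mspSub M ψ Bᶜ).mulVec v = mspTarget K e ⬝ᵥ v := by
    rw [dotProduct_mulVec, ← mulVec_transpose, hu]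
  obtain ⟨k, -, hk⟩ := Finset.exists_ne_zero_of_sum_ne_zero (huv.trans_ne hεv)
  have hm0 : 0 < m := hm ▸ Fintype.card_pos_iff.2 ⟨k⟩
  let g₀ := (Fintype.equivFinOfCardEq hm).symm
  let g := g₀.trans (Equiv.swap (g₀ ⟨0, hm0⟩) k)
  have hg : g ⟨0, hm0⟩ = k := by simp [g]
  let N : Matrix (Fin m) (Fin (e + 1)) K := Matrix.of fun i j => mspSub M ψ Bᶜ (g i) j
  have hN : (u ∘ g) ᵥ* N = mspTarget K e := by
    rw [← hu, mulVec_transpose]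
    ext j
    exact g.sum_comp fun l => u l * mspSub M ψ Bᶜ l j
  have hw : N.mulVec v ⟨0, hm0⟩ ≠ 0 := by
    change (mspSub M ψ Bᶜ).mulVec v (g ⟨0, hm0⟩) ≠ 0
    rw [hg]
    exact right_ne_zero_of_mul hk
  have huw : (u ∘ g) ⬝ᵥ N.mulVec v ≠ 0 := by
    rwa [dotProduct_mulVec, hN]
  obtain ⟨U, hU, hU0, hUi⟩ := exists_isUnit_det_row_eq_orthogonal hw huw
  have hrow : (U * N) ⟨0, hm0⟩ = mspTarget K e := by
    rw [mul_apply_eq_vecMul, hU0, hN]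
  refine ⟨hm0, g, U, v, hU, hrow, fun s a => ?_, hv, hεv, hUi⟩
  rw [mulVec_mulVec]
  change (U * N) ⟨0, hm0⟩ ⬝ᵥ _ = s
  rw [hrow]
  simp [mspTarget]
end

section
/- Let (K, M, ψ) be a monotone span program over a player set P computing the monotone function f. Let B ⊆ P with f(B) = 0, let A = P \ B with f(A) = 1, and let m be the number of rows of M labeled in A. Then there exists an invertible m × m matrix U over K such that for every s ∈ K: (1) the first coordinate of U M_A (s; a) equals s for every a ∈ K^{e-1}; and (2) there is a bijection σ_s : K^{e-1} → K^{e-1} such that for every a ∈ K^{e-1}, the pair consisting of the last m−1 coordinates of U M_A (s; a) together with M_B (s; a) equals the pair consisting of the last m−1 coordinates of U M_A (0; σ_s(a)) together with M_B (0; σ_s(a)). (That is, after applying U to the shares of A, the first coordinate carries the secret and the joint distribution of all remaining coordinates, for uniformly random a, is independent of s.) -/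
open Matrix

/-- Fredholm alternative: a vector outside the row space of `N` is separated from it by a vector
in the kernel of `N`. -/
theorem exists_mulVec_eq_zero_dotProduct_eq_one {K m n : Type*} [Field K] [Fintype m] [Fintype n]
    (N : Matrix m n K) (t : n → K) (ht : ¬ ∃ u, Nᵀ *ᵥ u = t) :
    ∃ v, N *ᵥ v = 0 ∧ t ⬝ᵥ v = 1 := by
  classical
  have ht' : t ∉ LinearMap.range Nᵀ.mulVecLin := fun ⟨u, hu⟩ => ht ⟨u, hu⟩
  obtain ⟨f, hft, hf⟩ := Submodule.exists_le_ker_of_notMem ht'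
  have hdot : ∀ x, f x = x ⬝ᵥ (dotProductEquiv K n).symm f := fun x => by
    conv_lhs => rw [← (dotProductEquiv K n).apply_symm_apply f]
    rw [dotProductEquiv_apply_apply, dotProduct_comm]
  refine ⟨(f t)⁻¹ • (dotProductEquiv K n).symm f, ?_, ?_⟩
  · rw [mulVec_smul]
    refine smul_eq_zero_of_right _ (dotProduct_eq_zero _ fun u => ?_)
    have hu : f (Nᵀ *ᵥ u) = 0 := hf ⟨u, rfl⟩
    rwa [hdot, mulVec_transpose, ← dotProduct_mulVec, dotProduct_comm] at hu
  · rw [dotProduct_smul, ← hdot, smul_eq_mul, inv_mul_cancel₀ hft]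

/-- If `u ⬝ᵥ w = 1` and `w i₀ ≠ 0`, then `u` is the row `i₀` of an invertible matrix all of whose
other rows are orthogonal to `w`. -/
theorem exists_isUnit_det_row_eq_mulVec_eq_zero {K n : Type*} [Field K] [Fintype n] [DecidableEq n]
    {u w : n → K} {i₀ : n} (hw : w i₀ ≠ 0) (huw : u ⬝ᵥ w = 1) :
    ∃ U : Matrix n n K, IsUnit U.det ∧ U i₀ = u ∧ ∀ i ≠ i₀, (U *ᵥ w) i = 0 := by
  let U : Matrix n n K :=
    Function.update (fun i => Pi.single i 1 - Pi.single i₀ (w i / w i₀)) i₀ u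
  have hrow : U i₀ = u := Function.update_self ..
  have hU : ∀ (x : n → K) (i : n), i ≠ i₀ → (U *ᵥ x) i = x i - w i / w i₀ * x i₀ := by
    intro x i hi
    have hUi : U i = Pi.single i 1 - Pi.single i₀ (w i / w i₀) := Function.update_of_ne hi _ _
    rw [mulVec, hUi, sub_dotProduct, single_one_dotProduct, single_dotProduct]
  refine ⟨U, ?_, hrow, fun i hi => by rw [hU w i hi, div_mul_cancel₀ _ hw, sub_self]⟩
  rw [← isUnit_iff_isUnit_det, ← mulVec_injective_iff_isUnit]
  refine (injective_iff_map_eq_zero U.mulVecLin).2 fun x hx => ?_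
  replace hx : U *ᵥ x = 0 := hx
  have hxw : x = (x i₀ / w i₀) • w := by
    ext i
    rcases eq_or_ne i i₀ with rfl | hi
    · simp [hw]
    · have := hU x i hi
      rw [hx, Pi.zero_apply] at this
      rw [Pi.smul_apply, smul_eq_mul, eq_of_sub_eq_zero this.symm]
      ring
  have h₀ : u ⬝ᵥ x = 0 := by
    have := congrFun hx i₀
    rwa [mulVec, hrow] at this
  rw [hxw, dotProduct_smul, huw, smul_eq_mul, mul_one] at h₀
  rw [hxw, h₀, zero_smul]

/-- Lemma 1 of the paper: let `B` be unqualified (`f(B) = 0`) and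
`A = P \ B` qualified (`f(A) = 1`), and let `m` be the number of rows of `M`
labelled in `A`.  Then there is an invertible `m × m` matrix `U` (acting on
the shares of `A`, enumerated by some bijection `g`) such that for every
secret `s`: (1) the first coordinate of `U M_A (s; a)` equals `s` for every
`a`; and (2) there is a bijection `σ_s` of the randomness space `K^e` such
that for every `a`, the remaining `m - 1` coordinates of `U M_A (s; a)`
together with the shares `M_B (s; a)` coincide with the remaining coordinates
of `U M_A (0; σ_s(a))` together with `M_B (0; σ_s(a))`; i.e. for uniformly
random `a`, everything except the first coordinate is distributed
independently of `s`. -/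
theorem msp_reconstruction_and_independence
    {P : Type*} [Fintype P] [DecidableEq P] {K : Type*} [Field K] [Fintype K]
    {d e : ℕ} (M : Matrix (Fin d) (Fin (e + 1)) K) (ψ : Fin d → P) (B : Finset P)
    {m : ℕ} (hm : Fintype.card {l : Fin d // ψ l ∈ Bᶜ} = m)
    (hB : ¬ ∃ u : {l : Fin d // ψ l ∈ B} → K,
      (mspSub M ψ B)ᵀ.mulVec u = mspTarget K e)
    (hA : ∃ u : {l : Fin d // ψ l ∈ Bᶜ} → K,
      (mspSub M ψ Bᶜ)ᵀ.mulVec u = mspTarget K e) :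
    ∃ (hm0 : 0 < m) (g : Fin m ≃ {l : Fin d // ψ l ∈ Bᶜ})
      (U : Matrix (Fin m) (Fin m) K),
      IsUnit U.det ∧
      ∀ s : K,
        -- (1) the first coordinate of `U M_A (s; a)` carries the secret:
        (∀ a : Fin e → K,
          U.mulVec ((Matrix.of fun i j => mspSub M ψ Bᶜ (g i) j).mulVec (Fin.cons s a))
            ⟨0, hm0⟩ = s) ∧
        -- (2) all other coordinates, jointly with the shares of `B`, are
        -- independent of `s` (via a bijection of the randomness):
        ∃ σ : (Fin e → K) ≃ (Fin e → K), ∀ a : Fin e → K,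
          (∀ i : Fin m, i ≠ ⟨0, hm0⟩ →
            U.mulVec ((Matrix.of fun i j => mspSub M ψ Bᶜ (g i) j).mulVec (Fin.cons s a)) i =
            U.mulVec ((Matrix.of fun i j => mspSub M ψ Bᶜ (g i) j).mulVec (Fin.cons 0 (σ a)))
              i) ∧
          (mspSub M ψ B).mulVec (Fin.cons s a) =
            (mspSub M ψ B).mulVec (Fin.cons 0 (σ a)) := by
  obtain ⟨v, hBv, hv⟩ := exists_mulVec_eq_zero_dotProduct_eq_one _ _ hB
  obtain ⟨u, hu⟩ := hA
  have hsecret : ∀ x, u ⬝ᵥ (mspSub M ψ Bᶜ *ᵥ x) = x 0 := fun x => by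
    rw [dotProduct_mulVec, ← mulVec_transpose, hu, mspTarget, single_one_dotProduct]
  replace hv : v 0 = 1 := by rwa [mspTarget, single_one_dotProduct] at hv
  obtain ⟨l, hl⟩ : ∃ l, (mspSub M ψ Bᶜ *ᵥ v) l ≠ 0 := by
    by_contra! h
    have h₁ := hsecret v
    rw [funext h, hv] at h₁
    exact zero_ne_one ((dotProduct_zero u).symm.trans h₁)
  have hm0 : 0 < m := hm ▸ Fintype.card_pos_iff.2 ⟨l⟩
  let g₀ := (Fintype.equivFinOfCardEq hm).symm
  let g : Fin m ≃ {l : Fin d // ψ l ∈ Bᶜ} := g₀.trans (Equiv.swap (g₀ ⟨0, hm0⟩) l)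
  have hg : g ⟨0, hm0⟩ = l := Equiv.swap_apply_left _ _
  let N : Matrix (Fin m) (Fin (e + 1)) K := Matrix.of fun i j => mspSub M ψ Bᶜ (g i) j
  have hNmul : ∀ x, N *ᵥ x = (mspSub M ψ Bᶜ *ᵥ x) ∘ g := fun x => rfl
  have hNsecret : ∀ x, (u ∘ g) ⬝ᵥ (N *ᵥ x) = x 0 := fun x => by
    rw [hNmul, comp_equiv_dotProduct_comp_equiv, hsecret]
  obtain ⟨U, hUdet, hU₀, hUv⟩ := exists_isUnit_det_row_eq_mulVec_eq_zero (i₀ := ⟨0, hm0⟩)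
    (u := u ∘ g) (w := N *ᵥ v) (by rwa [hNmul, Function.comp_apply, hg])
    ((hNsecret v).trans hv)
  refine ⟨hm0, g, U, hUdet, fun s => ⟨fun a => ?_, Equiv.subRight (s • Fin.tail v), fun a => ?_⟩⟩
  · rw [mulVec, hU₀, hNsecret, Fin.cons_zero]
  · have hshift : (Fin.cons 0 (Equiv.subRight (s • Fin.tail v) a) : Fin (e + 1) → K) =
        Fin.cons s a - s • v := by
      ext j
      refine Fin.cases ?_ (fun j => ?_) j
      · simp [hv]
      · simp [Fin.tail]
    rw [hshift]
    refine ⟨fun i hi => ?_, ?_⟩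
    · change (U *ᵥ (N *ᵥ _)) i = (U *ᵥ (N *ᵥ _)) i
      rw [mulVec_sub, mulVec_smul, mulVec_sub, mulVec_smul, Pi.sub_apply, Pi.smul_apply, hUv i hi,
        smul_zero, sub_zero]
    · rw [mulVec_sub, mulVec_smul, hBv, smul_zero, sub_zero]
end

section
/- Let (K, M, ψ) be a monotone span program over a player set P computing the monotone function f, where the d × e matrix M has rank e (so M : K^e → K^d is injective). Let B ⊆ P with f(B) = 0 and f(P \ B) = 1, let R_B be the set of row indices labeled in B and R_A its complement in {1,…,d}. For α : K → ℂ define ψ_α : K^d → ℂ by ψ_α(y) = α(s) if y = M (s; a) for some (necessarily unique) s ∈ K, a ∈ K^{e-1}, and ψ_α(y) = 0 otherwise; and define the reduced density matrix ρ_B(α), indexed by pairs of vectors in K^{R_B}, by ρ_B(α)(y_B, y'_B) = Σ_{y_A ∈ K^{R_A}} ψ_α(y_A ⊕ y_B) · conj(ψ_α(y_A ⊕ y'_B)), where y_A ⊕ y_B denotes the vector in K^d with coordinates y_A on R_A and y_B on R_B. Then for any two α, α' : K → ℂ with Σ_{s} |α(s)|² = Σ_{s} |α'(s)|² = 1, we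 have ρ_B(α) = ρ_B(α'). (The quantum encoding reveals no information about the encoded state to the players in B.) -/
open Matrix

/-- The (unnormalized) amplitude of the basis state `|y⟩` in the quantum
encoding of `Σ_s α(s)|s⟩`: it is `α(s)` if `y = M (s; a)` for some (by
injectivity of `M`, necessarily unique) `s ∈ K` and `a ∈ K^e`, and `0`
otherwise. -/
noncomputable def psiEnc {K : Type*} [Field K] [Fintype K] {d e : ℕ}
    (M : Matrix (Fin d) (Fin (e + 1)) K) (α : K → ℂ) (y : Fin d → K) : ℂ :=
  @dite ℂ (∃ s : K, ∃ a : Fin e → K, y = M.mulVec (Fin.cons s a))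
    (Classical.propDecidable _) (fun h => α h.choose) (fun _ => 0)

/-- The vector in `K^d` whose coordinates on the rows labelled outside `B` are
given by `yA` and whose coordinates on the rows labelled in `B` are `yB`. -/
def combineShares {P : Type*} [DecidableEq P] {K : Type*} {d : ℕ}
    (ψ : Fin d → P) (B : Finset P)
    (yA : {l : Fin d // ψ l ∉ B} → K) (yB : {l : Fin d // ψ l ∈ B} → K) :
    Fin d → K :=
  fun l => if h : ψ l ∈ B then yB ⟨l, h⟩ else yA ⟨l, h⟩

/-- The reduced density matrix of the shares of `B` in the quantum encoding of
`Σ_s α(s)|s⟩` (obtained by tracing out the shares of the complement of `B`). -/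
noncomputable def rhoB {P : Type*} [Fintype P] [DecidableEq P]
    {K : Type*} [Field K] [Fintype K] {d e : ℕ}
    (M : Matrix (Fin d) (Fin (e + 1)) K) (ψ : Fin d → P) (B : Finset P)
    (α : K → ℂ) (yB yB' : {l : Fin d // ψ l ∈ B} → K) : ℂ :=
  ∑ yA : {l : Fin d // ψ l ∉ B} → K,
    psiEnc M α (combineShares ψ B yA yB) *
      (starRingEnd ℂ) (psiEnc M α (combineShares ψ B yA yB'))

/-- The vector `y` is one of the share vectors that occur in the encoding of the secret `s`. -/
def IsShareVector {K : Type*} [Field K] {d e : ℕ} (M : Matrix (Fin d) (Fin (e + 1)) K)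
    (s : K) (y : Fin d → K) : Prop :=
  ∃ x : Fin (e + 1) → K, x 0 = s ∧ y = M.mulVec x

/-- A set of players whose rows do not span the target vector admits a sweeping vector. -/
theorem exists_sweeping_vector {P : Type*} [DecidableEq P] {K : Type*} [Field K] {d e : ℕ}
    (M : Matrix (Fin d) (Fin (e + 1)) K) (ψ : Fin d → P) (B : Finset P)
    (hB : ¬ ∃ u : {l : Fin d // ψ l ∈ B} → K,
      (mspSub M ψ B)ᵀ.mulVec u = mspTarget K e) :
    ∃ κ : Fin (e + 1) → K, κ 0 = 1 ∧ ∀ l, ψ l ∈ B → M.mulVec κ l = 0 := by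
  have hmem : mspTarget K e ∉ LinearMap.range (mspSub M ψ B)ᵀ.mulVecLin := by
    rintro ⟨u, hu⟩
    exact hB ⟨u, hu⟩
  obtain ⟨f, hf, hmap⟩ := Submodule.exists_dual_map_eq_bot_of_notMem hmem inferInstance
  have hker := LinearMap.le_ker_iff_map.mpr hmap
  have happly (v : Fin (e + 1) → K) : f v = ∑ j, v j * f (Pi.single j 1) := by
    rw [f.pi_apply_eq_sum_univ v]
    refine Finset.sum_congr rfl fun j _ => ?_
    rw [smul_eq_mul]
    congr 2
    ext i
    simp [Pi.single_apply, eq_comm]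
  refine ⟨fun j => (f (mspTarget K e))⁻¹ * f (Pi.single j 1), inv_mul_cancel₀ hf, fun l hl => ?_⟩
  have hrow : f (M l) = 0 := by
    refine hker ⟨Pi.single ⟨l, hl⟩ 1, ?_⟩
    ext j
    simp [mspSub]
  rw [happly] at hrow
  calc M.mulVec (fun j => (f (mspTarget K e))⁻¹ * f (Pi.single j 1)) l
      = (f (mspTarget K e))⁻¹ * ∑ j, M l j * f (Pi.single j 1) := by
        simp only [Matrix.mulVec, dotProduct, Finset.mul_sum]
        exact Finset.sum_congr rfl fun j _ => by ring
    _ = 0 := by rw [hrow, mul_zero]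

/-- A set of players whose rows span the target vector determines the secret. -/
theorem IsShareVector.secret_eq {P : Type*} [DecidableEq P] {K : Type*} [Field K] {d e : ℕ}
    {M : Matrix (Fin d) (Fin (e + 1)) K} {ψ : Fin d → P} {A : Finset P}
    (hA : ∃ u : {l : Fin d // ψ l ∈ A} → K,
      (mspSub M ψ A)ᵀ.mulVec u = mspTarget K e)
    {s t : K} {y z : Fin d → K} (hy : IsShareVector M s y) (hz : IsShareVector M t z)
    (hyz : ∀ l, ψ l ∈ A → y l = z l) : s = t := by
  obtain ⟨u, hu⟩ := hA
  obtain ⟨x, rfl, rfl⟩ := hy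
  obtain ⟨x', rfl, rfl⟩ := hz
  have hrec (v : Fin (e + 1) → K) : v 0 = u ⬝ᵥ (mspSub M ψ A).mulVec v := by
    rw [Matrix.dotProduct_mulVec, ← Matrix.mulVec_transpose, hu, mspTarget, single_dotProduct,
      one_mul]
  rw [hrec x, hrec x']
  congr 1
  ext l
  exact hyz l l.2

open Classical in
theorem psiEnc_eq_sum {P : Type*} [DecidableEq P] {K : Type*} [Field K] [Fintype K] {d e : ℕ}
    {M : Matrix (Fin d) (Fin (e + 1)) K} {ψ : Fin d → P} {A : Finset P}
    (hA : ∃ u : {l : Fin d // ψ l ∈ A} → K,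
      (mspSub M ψ A)ᵀ.mulVec u = mspTarget K e) (α : K → ℂ) (y : Fin d → K) :
    psiEnc M α y = ∑ s, if IsShareVector M s y then α s else 0 := by
  unfold psiEnc
  split_ifs with h
  · have hs : IsShareVector M h.choose y :=
      let ⟨a, ha⟩ := h.choose_spec
      ⟨Fin.cons h.choose a, rfl, ha⟩
    rw [Finset.sum_eq_single h.choose, if_pos hs]
    · intro t _ ht
      exact if_neg fun hty => ht (hty.secret_eq hA hs fun _ _ => rfl)
    · simp
  · refine (Finset.sum_eq_zero fun s _ => if_neg ?_).symm
    rintro ⟨x, rfl, hx⟩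
    exact h ⟨x 0, Fin.tail x, by rw [Fin.cons_self_tail, hx]⟩

theorem IsShareVector.add {K : Type*} [Field K] {d e : ℕ} {M : Matrix (Fin d) (Fin (e + 1)) K}
    {s : K} {y : Fin d → K} (hy : IsShareVector M s y) (x : Fin (e + 1) → K) :
    IsShareVector M (s + x 0) (y + M.mulVec x) := by
  obtain ⟨x', rfl, rfl⟩ := hy
  exact ⟨x' + x, rfl, (Matrix.mulVec_add M x' x).symm⟩

theorem isShareVector_add_iff {K : Type*} [Field K] {d e : ℕ}
    {M : Matrix (Fin d) (Fin (e + 1)) K} {s : K} {y : Fin d → K} (x : Fin (e + 1) → K) :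
    IsShareVector M (s + x 0) (y + M.mulVec x) ↔ IsShareVector M s y := by
  refine ⟨fun h => ?_, fun h => h.add x⟩
  simpa [Matrix.mulVec_neg] using h.add (-x)

open Classical in
/-- The number of ways to complete both `yB` and `yB'` to share vectors of `s`
by the same shares outside `B`. -/
noncomputable def completionCount {P : Type*} [DecidableEq P] {K : Type*} [Field K] [Fintype K]
    {d e : ℕ} (M : Matrix (Fin d) (Fin (e + 1)) K) (ψ : Fin d → P) (B : Finset P) (s : K)
    (yB yB' : {l : Fin d // ψ l ∈ B} → K) : ℂ :=
  ∑ yA : {l : Fin d // ψ l ∉ B} → K,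
    if IsShareVector M s (combineShares ψ B yA yB) ∧
      IsShareVector M s (combineShares ψ B yA yB') then 1 else 0

theorem completionCount_eq {P : Type*} [DecidableEq P] {K : Type*} [Field K] [Fintype K]
    {d e : ℕ} {M : Matrix (Fin d) (Fin (e + 1)) K} {ψ : Fin d → P} {B : Finset P}
    (hB : ¬ ∃ u : {l : Fin d // ψ l ∈ B} → K,
      (mspSub M ψ B)ᵀ.mulVec u = mspTarget K e) (s : K)
    (yB yB' : {l : Fin d // ψ l ∈ B} → K) :
    completionCount M ψ B s yB yB' = completionCount M ψ B 0 yB yB' := by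
  classical
  obtain ⟨κ, hκ, hκB⟩ := exists_sweeping_vector M ψ B hB
  have hshift (yA : {l : Fin d // ψ l ∉ B} → K) (y : {l : Fin d // ψ l ∈ B} → K) :
      combineShares ψ B (yA + fun l : {l : Fin d // ψ l ∉ B} => M.mulVec (s • κ) l) y =
        combineShares ψ B yA y + M.mulVec (s • κ) := by
    ext l
    by_cases hl : ψ l ∈ B
    · simp [combineShares, hl, Matrix.mulVec_smul, hκB l hl]
    · simp [combineShares, hl]
  have hiff (y : Fin d → K) :
      IsShareVector M s (y + M.mulVec (s • κ)) ↔ IsShareVector M 0 y := by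
    simpa [hκ] using isShareVector_add_iff (M := M) (s := 0) (y := y) (s • κ)
  unfold completionCount
  rw [← Equiv.sum_comp (Equiv.addRight fun l : {l : Fin d // ψ l ∉ B} => M.mulVec (s • κ) l)]
  simp only [Equiv.coe_addRight, hshift, hiff]

theorem rhoB_eq_sum {P : Type*} [Fintype P] [DecidableEq P] {K : Type*} [Field K] [Fintype K]
    {d e : ℕ} {M : Matrix (Fin d) (Fin (e + 1)) K} {ψ : Fin d → P} {B : Finset P}
    (hA : ∃ u : {l : Fin d // ψ l ∈ Bᶜ} → K,
      (mspSub M ψ Bᶜ)ᵀ.mulVec u = mspTarget K e)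
    (α : K → ℂ) (yB yB' : {l : Fin d // ψ l ∈ B} → K) :
    rhoB M ψ B α yB yB' = ∑ s, (‖α s‖ : ℂ) ^ 2 * completionCount M ψ B s yB yB' := by
  classical
  simp only [rhoB, completionCount, Finset.mul_sum]
  rw [Finset.sum_comm]
  refine Finset.sum_congr rfl fun yA _ => ?_
  rw [psiEnc_eq_sum hA, psiEnc_eq_sum hA, map_sum, Finset.sum_mul]
  refine Finset.sum_congr rfl fun s _ => ?_
  by_cases hs : IsShareVector M s (combineShares ψ B yA yB)
  · rw [Finset.mul_sum, Finset.sum_eq_single s]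
    · by_cases hs' : IsShareVector M s (combineShares ψ B yA yB')
      · simp [hs, hs', Complex.mul_conj']
      · simp [hs']
    · intro t _ hts
      have ht : ¬ IsShareVector M t (combineShares ψ B yA yB') := fun ht =>
        hts (ht.secret_eq hA hs fun l hl => by simp [combineShares, Finset.mem_compl.mp hl])
      rw [if_neg ht, map_zero, mul_zero]
    · simp
  · simp [hs]

/-- Security of the quantum encoding derived from a monotone span program: if
`M` has full column rank (so the encoding map is injective), `B` is
unqualified (`f(B) = 0`) and its complement is qualified (`f(P \ B) = 1`),
then the reduced density matrix of the shares of `B` is the same for all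
normalized input states `α`; i.e. the players in `B` obtain no information
about the encoded quantum secret. -/
theorem msp_quantum_encoding_secure
    {P : Type*} [Fintype P] [DecidableEq P] {K : Type*} [Field K] [Fintype K]
    {d e : ℕ} (M : Matrix (Fin d) (Fin (e + 1)) K) (ψ : Fin d → P) (B : Finset P)
    (hMinj : Function.Injective M.mulVec)
    (hB : ¬ ∃ u : {l : Fin d // ψ l ∈ B} → K,
      (mspSub M ψ B)ᵀ.mulVec u = mspTarget K e)
    (hA : ∃ u : {l : Fin d // ψ l ∈ Bᶜ} → K,
      (mspSub M ψ Bᶜ)ᵀ.mulVec u = mspTarget K e)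
    (α α' : K → ℂ)
    (hα : ∑ s : K, ‖α s‖ ^ 2 = 1) (hα' : ∑ s : K, ‖α' s‖ ^ 2 = 1) :
    rhoB M ψ B α = rhoB M ψ B α' := by
  have key (β : K → ℂ) (hβ : ∑ s : K, ‖β s‖ ^ 2 = 1)
      (yB yB' : {l : Fin d // ψ l ∈ B} → K) :
      rhoB M ψ B β yB yB' = completionCount M ψ B 0 yB yB' := by
    rw [rhoB_eq_sum hA, Finset.sum_congr rfl fun s _ => by rw [completionCount_eq hB],
      ← Finset.sum_mul]
    have hβ' : ∑ s : K, (‖β s‖ : ℂ) ^ 2 = 1 := by exact_mod_cast hβ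
    rw [hβ', one_mul]
  ext yB yB'
  rw [key α hα, key α' hα']
end

section
/- Let A be a Q²* adversary structure over a finite set P, let τ be an element not in P, and set P' = P ∪ {τ} and A' = A ∪ { B ∪ {τ} : B ∈ A* }, where A* is the dual of A in 2^P. Then: (1) A' is an adversary structure over P' (downward closed); (2) A' is self-dual, i.e. A' equals its dual taken with respect to P'; and (3) the restriction of A' to P gives back A: {B ∈ A' : B ⊆ P} = A. -/
/-- The dual of a collection `A` of subsets of the player set `P ⊆ Ω`:
`A* = {B ⊆ P : P \ B ∉ A}`. -/
def advDualIn {Ω : Type*} (P : Set Ω) (A : Set (Set Ω)) : Set (Set Ω) :=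
  {B : Set Ω | B ⊆ P ∧ P \ B ∉ A}

/-- The extension of an adversary structure `A` over `P` to the player set
`P ∪ {τ}`: `A' = A ∪ {B ∪ {τ} : B ∈ A*}`. -/
def advExtend {Ω : Type*} (P : Set Ω) (τ : Ω) (A : Set (Set Ω)) : Set (Set Ω) :=
  A ∪ {C : Set Ω | ∃ B ∈ advDualIn P A, C = B ∪ {τ}}

/-- A set avoiding `τ` belongs to the extension of `A` iff it belongs to `A`. -/
theorem mem_advExtend_of_notMem {Ω : Type*} {P : Set Ω} {τ : Ω} {A : Set (Set Ω)} {C : Set Ω}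
    (hC : τ ∉ C) : C ∈ advExtend P τ A ↔ C ∈ A := by
  refine ⟨?_, Or.inl⟩
  rintro (h | ⟨B, -, rfl⟩)
  · exact h
  · exact absurd (Or.inr rfl) hC

/-- A set containing `τ` belongs to the extension of `A` iff it is a set of players of `P ∪ {τ}`
whose complement is not in `A`. -/
theorem mem_advExtend_of_mem {Ω : Type*} {P : Set Ω} {τ : Ω} (hτ : τ ∉ P) {A : Set (Set Ω)}
    (hsub : ∀ B ∈ A, B ⊆ P) {C : Set Ω} (hC : τ ∈ C) :
    C ∈ advExtend P τ A ↔ C ⊆ P ∪ {τ} ∧ P \ C ∉ A := by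
  constructor
  · rintro (h | ⟨B, ⟨hBP, hB⟩, rfl⟩)
    · exact absurd (hsub C h hC) hτ
    · refine ⟨Set.union_subset_union_left _ hBP, ?_⟩
      rwa [← Set.sdiff_sdiff, Set.sdiff_singleton_eq_self fun h => hτ h.1]
  · rintro ⟨hCP, hCA⟩
    refine Or.inr ⟨C ∩ P, ⟨Set.inter_subset_right, by rwa [Set.sdiff_inter_self_eq_sdiff]⟩, ?_⟩
    ext x
    have := @hCP x
    simp only [Set.mem_union, Set.mem_inter_iff, Set.mem_singleton_iff] at this ⊢
    grind

/-- If the dual of `A` is `Q²`, then it is contained in `A`. -/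
theorem mem_of_mem_advDualIn {Ω : Type*} {P : Set Ω} {A : Set (Set Ω)}
    (hQ2star : ¬ ∃ B₁ ∈ advDualIn P A, ∃ B₂ ∈ advDualIn P A, B₁ ∪ B₂ = P) {B : Set Ω}
    (hB : B ∈ advDualIn P A) : B ∈ A := by
  by_contra hBA
  refine hQ2star ⟨B, hB, P \ B, ⟨Set.sdiff_subset, ?_⟩, Set.union_sdiff_cancel hB.1⟩
  rwa [Set.sdiff_sdiff_cancel_left hB.1]

/-- Extending a `Q²*` adversary structure to a self-dual one (Lemma 3 of the
paper).  Let `A` be a `Q²*` adversary structure over a finite player set `P`,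
let `τ ∉ P` be a new player, `P' = P ∪ {τ}`, and
`A' = A ∪ {B ∪ {τ} : B ∈ A*}`.  Then: (1) `A'` is an adversary structure over
`P'` (its members are subsets of `P'` and it is downward closed); (2) `A'` is
self-dual with respect to `P'`; and (3) the restriction of `A'` to `P` is
`A`. -/
theorem advExtend_selfDual {Ω : Type*} [Fintype Ω] (P : Set Ω) (τ : Ω) (hτ : τ ∉ P)
    (A : Set (Set Ω))
    (hsub : ∀ B ∈ A, B ⊆ P)
    (hdc : ∀ B ∈ A, ∀ B' ⊆ B, B' ∈ A)
    (hQ2star : ¬ ∃ B₁ ∈ advDualIn P A, ∃ B₂ ∈ advDualIn P A, B₁ ∪ B₂ = P) :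
    -- (1) `A'` is an adversary structure over `P' = P ∪ {τ}`:
    (∀ B ∈ advExtend P τ A, B ⊆ P ∪ {τ}) ∧
    (∀ B ∈ advExtend P τ A, ∀ B' ⊆ B, B' ∈ advExtend P τ A) ∧
    -- (2) `A'` is self-dual with respect to `P'`:
    advExtend P τ A = advDualIn (P ∪ {τ}) (advExtend P τ A) ∧
    -- (3) restricting `A'` to `P` gives back `A`:
    {B ∈ advExtend P τ A | B ⊆ P} = A := by
  have hsub' : ∀ B ∈ advExtend P τ A, B ⊆ P ∪ {τ} := by
    rintro B (h | ⟨B, hB, rfl⟩)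
    · exact (hsub B h).trans Set.subset_union_left
    · exact Set.union_subset_union_left _ hB.1
  refine ⟨hsub', ?_, ?_, ?_⟩
  · rintro C (hC | ⟨B, hB, rfl⟩) C' hC'
    · exact Or.inl (hdc C hC C' hC')
    by_cases hτC' : τ ∈ C'
    · rw [mem_advExtend_of_mem hτ hsub hτC']
      refine ⟨hC'.trans (Set.union_subset_union_left _ hB.1), fun h => hB.2 (hdc _ h _ ?_)⟩
      rintro x ⟨hxP, hxB⟩
      refine ⟨hxP, fun hx => ?_⟩
      rcases hC' hx with hx | rfl
      · exact hxB hx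
      · exact hτ hxP
    · refine Or.inl (hdc B (mem_of_mem_advDualIn hQ2star hB) C' fun x hx => ?_)
      rcases hC' hx with hxB | rfl
      · exact hxB
      · exact absurd hx hτC'
  · ext C
    by_cases hτC : τ ∈ C
    · have hcompl : (P ∪ {τ}) \ C = P \ C := by
        rw [Set.union_sdiff_distrib, Set.sdiff_eq_empty.2 (Set.singleton_subset_iff.2 hτC),
          Set.union_empty]
      rw [mem_advExtend_of_mem hτ hsub hτC, advDualIn, Set.mem_ofPred_eq, hcompl,
        mem_advExtend_of_notMem fun h => hτ h.1]
    · rw [advDualIn, Set.mem_ofPred_eq,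
        mem_advExtend_of_mem hτ hsub (C := (P ∪ {τ}) \ C) ⟨Or.inr rfl, hτC⟩,
        mem_advExtend_of_notMem hτC]
      have hcompl (hC : C ⊆ P) : P \ ((P ∪ {τ}) \ C) = C := by
        ext x
        have := @hC x
        simp only [Set.mem_sdiff, Set.mem_union]
        tauto
      constructor
      · intro hC
        refine ⟨(hsub C hC).trans Set.subset_union_left, fun h => h.2 ?_⟩
        rwa [hcompl (hsub C hC)]
      · rintro ⟨hCP', hC⟩
        have hCP : C ⊆ P := fun x hx => (hCP' hx).resolve_right fun h => hτC (h ▸ hx)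
        by_contra hCA
        exact hC ⟨Set.sdiff_subset, by rwa [hcompl hCP]⟩
  · ext C
    exact ⟨fun h => (mem_advExtend_of_notMem fun hτC => hτ (h.2 hτC)).1 h.1,
      fun h => ⟨Or.inl h, hsub C h⟩⟩
end

section
/- Consider a classical secret-sharing scheme (S, Y_u, Y_q, p, f) as in the context. Then the reduced density matrix ρ(α) of the unqualified part is the same for all normalized α : S → ℂ if and only if for all y₁, y₂ ∈ Y_u the quantity Σ_{y_q : f(y_q) = s} √(p(s)(y₁, y_q) · p(s)(y₂, y_q)) is independent of s ∈ S (i.e. takes the same value for every s ∈ S). -/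
open Finset

/-- The reduced density matrix of the unqualified part of the quantum encoding
of `Σ_s α(s)|s⟩` obtained from a classical secret-sharing scheme with
conditional share distribution `p` and reconstruction function `f`:
`ρ(α)(y₁, y₂) = Σ_s |α(s)|² Σ_{y_q : f(y_q) = s} √(p(s)(y₁,y_q))·√(p(s)(y₂,y_q))`.
(The entries are real, so `ρ` is valued in `ℝ`.) -/
noncomputable def rhoU {S Yu Yq : Type*} [Fintype S] [Fintype Yq] [DecidableEq S]
    (p : S → Yu × Yq → ℝ) (f : Yq → S) (α : S → ℂ) (y₁ y₂ : Yu) : ℝ :=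
  ∑ s : S, ‖α s‖ ^ 2 *
    ∑ yq ∈ univ.filter (fun yq => f yq = s),
      Real.sqrt (p s (y₁, yq)) * Real.sqrt (p s (y₂, yq))

/-- The reduced density matrix of a basis state `|s⟩` is the `s`-th conditional overlap. -/
theorem rhoU_single {S Yu Yq : Type*} [Fintype S] [Fintype Yq] [DecidableEq S]
    (p : S → Yu × Yq → ℝ) (f : Yq → S) (s : S) (y₁ y₂ : Yu) :
    rhoU p f (Pi.single s 1) y₁ y₂ =
      ∑ yq ∈ univ.filter (fun yq => f yq = s),
        Real.sqrt (p s (y₁, yq)) * Real.sqrt (p s (y₂, yq)) := by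
  unfold rhoU
  rw [Finset.sum_eq_single s]
  · simp
  · intro t _ hts
    simp [hts]
  · simp

/-- The general condition for a classical secret-sharing scheme to yield a
secure quantum one (Theorem 4 of the paper).  Given a classical scheme
`(S, Y_u, Y_q, p, f)` (with `p(s)` the distribution of the shares given the
secret `s`, and `f` the reconstruction function for the qualified set), the
reduced density matrix of the unqualified part is the same for all normalized
`α : S → ℂ` iff for all `y₁, y₂ ∈ Y_u` the quantity
`Σ_{y_q : f(y_q) = s} √(p(s)(y₁,y_q) · p(s)(y₂,y_q))` is independent of
`s ∈ S`. -/
theorem classical_to_quantum_condition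
    {S Yu Yq : Type*} [Fintype S] [Fintype Yu] [Fintype Yq] [Nonempty S]
    [DecidableEq S]
    (p : S → Yu × Yq → ℝ)
    (hpos : ∀ s y, 0 ≤ p s y)
    (hsum : ∀ s, ∑ y : Yu × Yq, p s y = 1)
    (f : Yq → S)
    (hcorr : ∀ s yu yq, 0 < p s (yu, yq) → f yq = s) :
    (∀ α α' : S → ℂ, (∑ s : S, ‖α s‖ ^ 2 = 1) → (∑ s : S, ‖α' s‖ ^ 2 = 1) →
        rhoU p f α = rhoU p f α') ↔
    (∀ (y₁ y₂ : Yu) (s s' : S),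
        ∑ yq ∈ univ.filter (fun yq => f yq = s),
          Real.sqrt (p s (y₁, yq) * p s (y₂, yq)) =
        ∑ yq ∈ univ.filter (fun yq => f yq = s'),
          Real.sqrt (p s' (y₁, yq) * p s' (y₂, yq))) := by
  simp only [Real.sqrt_mul (hpos _ _)]
  constructor
  · intro h y₁ y₂ s s'
    have hnorm : ∀ t : S, ∑ u : S, ‖(Pi.single t 1 : S → ℂ) u‖ ^ 2 = 1 := by
      intro t
      rw [Finset.sum_eq_single t] <;> simp +contextual
    rw [← rhoU_single p f s, ← rhoU_single p f s', h _ _ (hnorm s) (hnorm s')]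
  · intro h α α' hα hα'
    obtain ⟨s₀⟩ := ‹Nonempty S›
    funext y₁ y₂
    simp only [rhoU, h y₁ y₂ _ s₀, ← Finset.sum_mul, hα, hα']
end

section
/- Consider a classical secret-sharing scheme (S, Y_u, Y_q, p, f) as in the context, and suppose additionally that: (a) the unqualified shares are a deterministic function of the qualified shares, i.e. there exists g : Y_q → Y_u such that p(s)(y_u, y_q) > 0 implies y_u = g(y_q); and (b) secrecy holds: for every y_u ∈ Y_u, the marginal Σ_{y_q ∈ Y_q} p(s)(y_u, y_q) is independent of s ∈ S. Then for all y₁, y₂ ∈ Y_u, the quantity Σ_{y_q : f(y_q) = s} √(p(s)(y₁, y_q) · p(s)(y₂, y_q)) is independent of s ∈ S. (Hence such schemes yield secure quantum secret-sharing schemes.) -/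
open Finset

/-- Classical secret-sharing schemes in which the unqualified shares are a
deterministic function of the qualified shares (such as the Shamir scheme)
satisfy the condition for yielding a secure quantum secret-sharing scheme:
for all unqualified share-words `y₁, y₂`, the quantity
`Σ_{y_q : f(y_q) = s} √(p(s)(y₁,y_q) · p(s)(y₂,y_q))` is independent of the
secret `s`. -/
theorem deterministic_unqualified_schemes_satisfy_condition
    {S Yu Yq : Type*} [Fintype S] [Fintype Yu] [Fintype Yq] [Nonempty S]
    [DecidableEq S]
    (p : S → Yu × Yq → ℝ)
    (hpos : ∀ s y, 0 ≤ p s y)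
    (hsum : ∀ s, ∑ y : Yu × Yq, p s y = 1)
    (f : Yq → S)
    (hcorr : ∀ s yu yq, 0 < p s (yu, yq) → f yq = s)
    -- (a) the unqualified shares are a function of the qualified shares:
    (hdet : ∃ g : Yq → Yu, ∀ s yu yq, 0 < p s (yu, yq) → yu = g yq)
    -- (b) secrecy: the marginal distribution of the unqualified shares is
    -- independent of the secret:
    (hsecrecy : ∀ (yu : Yu) (s s' : S),
      ∑ yq : Yq, p s (yu, yq) = ∑ yq : Yq, p s' (yu, yq)) :
    ∀ (y₁ y₂ : Yu) (s s' : S),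
      ∑ yq ∈ univ.filter (fun yq => f yq = s),
        Real.sqrt (p s (y₁, yq) * p s (y₂, yq)) =
      ∑ yq ∈ univ.filter (fun yq => f yq = s'),
        Real.sqrt (p s' (y₁, yq) * p s' (y₂, yq)) := by
  obtain ⟨g, hg⟩ := hdet
  intro y₁ y₂ s s'
  rcases eq_or_ne y₁ y₂ with rfl | hne
  · have sum_eq_marginal : ∀ t, ∑ yq ∈ univ.filter (fun yq => f yq = t),
        Real.sqrt (p t (y₁, yq) * p t (y₁, yq)) = ∑ yq, p t (y₁, yq) := by
      intro t
      simp only [Real.sqrt_mul_self (hpos _ _)]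
      refine sum_filter_of_ne fun yq _ h => ?_
      exact hcorr t y₁ yq ((hpos _ _).lt_of_ne' h)
    rw [sum_eq_marginal, sum_eq_marginal, hsecrecy]
  · have sqrt_eq_zero : ∀ t yq, Real.sqrt (p t (y₁, yq) * p t (y₂, yq)) = 0 := by
      intro t yq
      rcases (hpos t (y₁, yq)).eq_or_lt with h₁ | h₁
      · simp [← h₁]
      rcases (hpos t (y₂, yq)).eq_or_lt with h₂ | h₂
      · simp [← h₂]
      exact absurd ((hg _ _ _ h₁).trans (hg _ _ _ h₂).symm) hne
    simp only [sqrt_eq_zero, sum_const_zero]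
end

section
/- Consider a group homomorphic secret-sharing scheme as in the context, and assume the secrecy property for the coordinate set U: for every y_u ∈ G^U, the cardinality of {v ∈ Gᵐ : (h(s, v))_U = y_u} is the same for all s ∈ G. Then for all y_u¹, y_u² ∈ G^U, the cardinality of { y_q ∈ G^Q : (y_u¹, y_q) ∈ h({s} × Gᵐ) and (y_u², y_q) ∈ h({s} × Gᵐ) } is the same for all s ∈ G. (Since h is injective, this quantity is exactly the sum over qualified share-words y_q of √(P(Y_u = y_u¹, Y_q = y_q | S = s) · P(Y_u = y_u², Y_q = y_q | S = s)) scaled by |G|ᵐ; its independence of s means group homomorphic schemes satisfy the condition for yielding a secure quantum secret-sharing scheme.) -/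
open Finset

/-- The element of `Gⁿ` whose restriction to the unqualified coordinates
(`i ∉ Q`) is `yu` and whose restriction to the qualified coordinates
(`i ∈ Q`) is `yq`. -/
def combineWord {G : Type*} {n : ℕ} (Q : Finset (Fin n))
    (yu : {i : Fin n // i ∉ Q} → G) (yq : {i : Fin n // i ∈ Q} → G) :
    Fin n → G :=
  fun i => if h : i ∈ Q then yq ⟨i, h⟩ else yu ⟨i, h⟩

/-- Left translation by a word that is trivial on the unqualified coordinates
only affects the qualified part of a combined word. -/
theorem mul_combineWord_of_eq_one {G : Type*} [Group G] {n : ℕ} {Q : Finset (Fin n)}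
    {g : Fin n → G} (hg : ∀ i ∉ Q, g i = 1)
    (yu : {i : Fin n // i ∉ Q} → G) (yq : {i : Fin n // i ∈ Q} → G) :
    g * combineWord Q yu yq = combineWord Q yu ((fun i => g i.1) * yq) := by
  funext i
  by_cases hi : i ∈ Q
  · simp [combineWord, hi]
  · simp [combineWord, hi, hg i hi]

/-- If the share-word of `(s' * s⁻¹, w)` is trivial on the unqualified
coordinates, translating by it sends share-words of `s` to share-words of `s'`
with the same unqualified part. -/
theorem exists_share_eq_combineWord_translate {G : Type*} [Group G] {m n : ℕ}
    (h : (G × (Fin m → G)) →* (Fin n → G)) {Q : Finset (Fin n)} {s s' : G}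
    {w : Fin m → G} (hw : ∀ i ∉ Q, h (s' * s⁻¹, w) i = 1)
    {yu : {i : Fin n // i ∉ Q} → G} {yq : {i : Fin n // i ∈ Q} → G}
    (hy : ∃ v : Fin m → G, h (s, v) = combineWord Q yu yq) :
    ∃ v : Fin m → G,
      h (s', v) = combineWord Q yu ((fun i => h (s' * s⁻¹, w) i.1) * yq) := by
  obtain ⟨v, hv⟩ := hy
  refine ⟨w * v, ?_⟩
  rw [← mul_combineWord_of_eq_one hw, ← hv, ← map_mul, Prod.mk_mul_mk, inv_mul_cancel_right]

/-- Group homomorphic secret-sharing schemes satisfy the condition for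
yielding a secure quantum secret-sharing scheme.  Let
`h : G × Gᵐ → Gⁿ` be an injective homomorphism (the shares of the secret
`s ∈ G` being `h(s, v)` for uniformly random `v ∈ Gᵐ`), and assume secrecy
for the unqualified coordinate set `U = {1,…,n} \ Q`: for every `y_u ∈ G^U`
the number of `v` with `h(s, v)|_U = y_u` is the same for all `s`.  Then for
all `y₁, y₂ ∈ G^U`, the number of qualified share-words `y_q ∈ G^Q` such that
both `(y₁, y_q)` and `(y₂, y_q)` lie in the image `h({s} × Gᵐ)` is the same
for all secrets `s ∈ G`.  (By injectivity of `h`, this count is exactly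
`|G|ᵐ · Σ_{y_q} √(P(Y_u = y₁, Y_q = y_q | S = s) · P(Y_u = y₂, Y_q = y_q | S = s))`.) -/
theorem homomorphic_scheme_satisfies_condition
    {G : Type*} [Group G] [Fintype G] [DecidableEq G] {m n : ℕ}
    (h : (G × (Fin m → G)) →* (Fin n → G)) (hinj : Function.Injective h)
    (Q : Finset (Fin n))
    (hsecrecy : ∀ (yu : {i : Fin n // i ∉ Q} → G) (s s' : G),
      (univ.filter (fun v : Fin m → G =>
        (fun i : {i : Fin n // i ∉ Q} => h (s, v) i.1) = yu)).card =
      (univ.filter (fun v : Fin m → G =>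
        (fun i : {i : Fin n // i ∉ Q} => h (s', v) i.1) = yu)).card) :
    ∀ (y₁ y₂ : {i : Fin n // i ∉ Q} → G) (s s' : G),
      (univ.filter (fun yq : {i : Fin n // i ∈ Q} → G =>
        (∃ v : Fin m → G, h (s, v) = combineWord Q y₁ yq) ∧
        (∃ v : Fin m → G, h (s, v) = combineWord Q y₂ yq))).card =
      (univ.filter (fun yq : {i : Fin n // i ∈ Q} → G =>
        (∃ v : Fin m → G, h (s', v) = combineWord Q y₁ yq) ∧
        (∃ v : Fin m → G, h (s', v) = combineWord Q y₂ yq))).card := by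
  have trivial_share (t : G) : ∃ w : Fin m → G, ∀ i ∉ Q, h (t, w) i = 1 := by
    have hpos : 0 < (univ.filter (fun v : Fin m → G =>
        (fun i : {i : Fin n // i ∉ Q} => h (t, v) i.1) = 1)).card := by
      rw [hsecrecy 1 t 1]
      refine card_pos.mpr ⟨1, mem_filter.mpr ⟨mem_univ _, ?_⟩⟩
      funext i
      exact congrFun (map_one h) i.1
    obtain ⟨w, hw⟩ := card_pos.mp hpos
    exact ⟨w, fun i hi => congrFun (mem_filter.mp hw).2 ⟨i, hi⟩⟩
  have card_le (y₁ y₂ : {i : Fin n // i ∉ Q} → G) (s s' : G) :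
      (univ.filter (fun yq : {i : Fin n // i ∈ Q} → G =>
        (∃ v : Fin m → G, h (s, v) = combineWord Q y₁ yq) ∧
        (∃ v : Fin m → G, h (s, v) = combineWord Q y₂ yq))).card ≤
      (univ.filter (fun yq : {i : Fin n // i ∈ Q} → G =>
        (∃ v : Fin m → G, h (s', v) = combineWord Q y₁ yq) ∧
        (∃ v : Fin m → G, h (s', v) = combineWord Q y₂ yq))).card := by
    obtain ⟨w, hw⟩ := trivial_share (s' * s⁻¹)
    refine card_le_card_of_injOn (fun yq => (fun i => h (s' * s⁻¹, w) i.1) * yq) ?_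
      (mul_right_injective _).injOn
    intro yq hyq
    obtain ⟨h₁, h₂⟩ := (mem_filter.mp (mem_coe.mp hyq)).2
    exact mem_coe.mpr (mem_filter.mpr ⟨mem_univ _,
      exists_share_eq_combineWord_translate h hw h₁,
      exists_share_eq_combineWord_translate h hw h₂⟩)
  exact fun y₁ y₂ s s' => le_antisymm (card_le y₁ y₂ s s') (card_le y₁ y₂ s' s)
end
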